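/- arXiv:1402.6012 — 12 statements merged into one kernel-verified Lean document; each statement's English description precedes it below -/
import Mathlib

section
/- Let t_0, …, t_{n−1} be a closed n-shell on a vertex set V with n ≥ 4. Then for every i (indices mod n), the triple intersection t_{i−1} ∩ t_i ∩ t_{i+1} consists of exactly one vertex; consequently t_{i−1} = {a_{i−1}, a_i, x_i}, t_i = {a_i, b_i, x_i} and t_{i+1} = {b_i, b_{i+1}, x_i}, where x_i is that common vertex. -/
/-- A closed `n`-shell: a family `t 0, …, t (n-1)` of 3-element subsets of the
vertex type `V` such that consecutive triangles (cyclically mod `n`) share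
exactly two vertices and cyclically non-adjacent distinct triangles share
exactly one vertex. -/
def IsClosedShell {V : Type*} [DecidableEq V] (n : ℕ) (t : ℕ → Finset V) : Prop :=
  (∀ i < n, (t i).card = 3) ∧
  (∀ i < n, (t i ∩ t ((i + 1) % n)).card = 2) ∧
  (∀ i < n, ∀ j < n, i ≠ j → (i + 1) % n ≠ j → (j + 1) % n ≠ i →
    (t i ∩ t j).card = 1)

theorem shell_three_sets {V : Type*} [DecidableEq V] (P Q R : Finset V) (p q r s : V)
    (hQ : Q.card = 3) (hPQ : (P ∩ Q).card = 2) (hQR : (Q ∩ R).card = 2)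
    (hPR : (P ∩ R).card = 1)
    (h1 : P \ Q = {p}) (h2 : Q \ R = {q}) (h3 : Q \ P = {r}) (h4 : R \ Q = {s}) :
    ∃ x : V, P ∩ Q ∩ R = {x} ∧ P = {p, q, x} ∧ Q = {q, r, x} ∧ R = {r, s, x} := by
  have hle : (P ∩ Q ∩ R).card ≤ 1 := by
    rw [← hPR]
    apply Finset.card_le_card
    intro y hy
    simp only [Finset.mem_inter] at hy ⊢
    tauto
  have hge : 1 ≤ (P ∩ Q ∩ R).card := by
    have e := Finset.card_union_add_card_inter (P ∩ Q) (Q ∩ R)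
    have u : ((P ∩ Q) ∪ (Q ∩ R)).card ≤ 3 := by
      rw [← hQ]
      apply Finset.card_le_card
      intro y hy
      simp only [Finset.mem_inter, Finset.mem_union] at hy ⊢
      tauto
    have e2 : (P ∩ Q) ∩ (Q ∩ R) = P ∩ Q ∩ R := by
      ext y
      simp only [Finset.mem_inter]
      tauto
    rw [e2] at e
    omega
  obtain ⟨x, hx⟩ := Finset.card_eq_one.mp (le_antisymm hle hge)
  have hqP : q ∈ P := by
    by_contra hq
    have : P ∩ Q ⊆ P ∩ Q ∩ R := by
      intro y hy
      have h := Finset.ext_iff.mp h2 y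
      simp only [Finset.mem_inter, Finset.mem_sdiff, Finset.mem_singleton] at hy h ⊢
      refine ⟨hy, ?_⟩
      by_contra hyR
      have := h.mp ⟨hy.2, hyR⟩
      exact hq (this ▸ hy.1)
    have := Finset.card_le_card this
    omega
  have hrR : r ∈ R := by
    by_contra hr
    have : Q ∩ R ⊆ P ∩ Q ∩ R := by
      intro y hy
      have h := Finset.ext_iff.mp h3 y
      simp only [Finset.mem_inter, Finset.mem_sdiff, Finset.mem_singleton] at hy h ⊢
      refine ⟨⟨?_, hy.1⟩, hy.2⟩
      by_contra hyP
      have := h.mp ⟨hy.1, hyP⟩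
      exact hr (this ▸ hy.2)
    have := Finset.card_le_card this
    omega
  simp only [Finset.ext_iff, Finset.mem_sdiff, Finset.mem_singleton] at h1 h2 h3 h4
  have hxx := hx
  simp only [Finset.ext_iff, Finset.mem_inter, Finset.mem_singleton] at hxx
  obtain ⟨c, hc⟩ := Finset.card_eq_one.mp hPR
  simp only [Finset.ext_iff, Finset.mem_inter, Finset.mem_singleton] at hc
  refine ⟨x, hx, ?_, ?_, ?_⟩ <;> ext y <;>
    simp only [Finset.mem_insert, Finset.mem_singleton] <;> grind

/-- In a closed `n`-shell with `n ≥ 4`, for every `i` the triple intersection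
`t (i-1) ∩ t i ∩ t (i+1)` (indices mod `n`) is a single vertex `x`, and
`t (i-1) = {a (i-1), a i, x}`, `t i = {a i, b i, x}`,
`t (i+1) = {b i, b (i+1), x}` where `a i` is the unique element of
`t i \ t (i+1)` and `b i` is the unique element of `t i \ t (i-1)`. -/
theorem closedShell_triple_intersection {V : Type*} [DecidableEq V]
    (n : ℕ) (hn : 4 ≤ n) (t : ℕ → Finset V) (hshell : IsClosedShell n t)
    (a b : ℕ → V)
    (ha : ∀ i < n, t i \ t ((i + 1) % n) = {a i})
    (hb : ∀ i < n, t i \ t ((i + n - 1) % n) = {b i}) :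
    ∀ i < n, ∃ x : V,
      t ((i + n - 1) % n) ∩ t i ∩ t ((i + 1) % n) = {x} ∧
      t ((i + n - 1) % n) = {a ((i + n - 1) % n), a i, x} ∧
      t i = {a i, b i, x} ∧
      t ((i + 1) % n) = {b i, b ((i + 1) % n), x} := by
  intro i hi
  obtain ⟨hc, h2, h1⟩ := hshell
  have hp : (i + n - 1) % n < n := Nat.mod_lt _ (by omega)
  have hs : (i + 1) % n < n := Nat.mod_lt _ (by omega)
  have ev : (i + 1) % n = if i + 1 = n then 0 else i + 1 := by
    split_ifs with h
    · rw [h, Nat.mod_self]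
    · exact Nat.mod_eq_of_lt (by omega)
  have ep : (i + n - 1) % n = if i = 0 then n - 1 else i - 1 := by
    split_ifs with h
    · subst h
      rw [Nat.mod_eq_of_lt] <;> omega
    · rw [show i + n - 1 = (i - 1) + n by omega, Nat.add_mod_right]
      exact Nat.mod_eq_of_lt (by omega)
  have e1 : ((i + n - 1) % n + 1) % n = i := by
    rw [Nat.mod_add_mod, show i + n - 1 + 1 = i + n by omega, Nat.add_mod_right]
    exact Nat.mod_eq_of_lt hi
  have e2 : ((i + 1) % n + n - 1) % n = i := by
    rw [show (i + 1) % n + n - 1 = (i + 1) % n + (n - 1) by omega, Nat.mod_add_mod,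
      show i + 1 + (n - 1) = i + n by omega, Nat.add_mod_right]
    exact Nat.mod_eq_of_lt hi
  have e3 : ((i + 1) % n + 1) % n ≠ (i + n - 1) % n := by
    rw [ep, ev]
    by_cases h : i + 1 = n
    · rw [if_pos h, Nat.mod_eq_of_lt (by omega)]
      split_ifs <;> omega
    · rw [if_neg h]
      by_cases hh : i + 1 + 1 = n
      · rw [hh, Nat.mod_self]
        split_ifs <;> omega
      · rw [Nat.mod_eq_of_lt (by omega)]
        split_ifs <;> omega
  have q1 := h2 _ hp
  rw [e1] at q1
  have a1 := ha _ hp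
  rw [e1] at a1
  have b1 := hb _ hs
  rw [e2] at b1
  refine shell_three_sets _ _ _ _ _ _ _ (hc i hi) q1 (h2 i hi) (h1 _ hp _ hs ?_ ?_ e3)
    a1 (ha i hi) (hb i hi) b1
  · rw [ep, ev]
    split_ifs <;> omega
  · rw [e1, ev]
    split_ifs <;> omega
end

section
/- Let t_0, …, t_{n−1} be a closed n-shell with n ≥ 4, with structural vertices a_i and b_i. Then the vertices a_0, …, a_{n−1} are pairwise distinct, and the vertices b_0, …, b_{n−1} are pairwise distinct. -/
theorem shell_local {V : Type*} [DecidableEq V] (A Anext B Bnext : Finset V) (x : V)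
    (hA : A \ Anext = {x}) (hB : B \ Bnext = {x}) (h1 : (A ∩ B).card = 1) (h2 : (Anext ∩ Bnext).card = 1)
    (h3 : (Anext ∩ B).Nonempty) (h4 : (A ∩ Bnext).Nonempty) : False := by
  obtain ⟨r, hr⟩ := h3
  obtain ⟨s, hs⟩ := h4
  obtain ⟨y, hy⟩ := Finset.card_eq_one.mp h1
  obtain ⟨z, hz⟩ := Finset.card_eq_one.mp h2
  simp only [Finset.ext_iff, Finset.mem_sdiff, Finset.mem_inter, Finset.mem_singleton] at *
  have hxA := (hA x).2 rfl
  have hxB := (hB x).2 rfl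
  have r1 : r ∈ Bnext := by
    by_contra h
    have := (hB r).1 ⟨hr.2, h⟩
    subst this
    exact hxA.2 hr.1
  have s1 : s ∈ Anext := by
    by_contra h
    have := (hA s).1 ⟨hs.1, h⟩
    subst this
    exact hxB.2 hs.2
  have e1 := (hz r).1 ⟨hr.1, r1⟩
  have e2 := (hz s).1 ⟨s1, hs.2⟩
  have e3 : s = r := e2.trans e1.symm
  subst e3
  have e4 := (hy s).1 ⟨hs.1, hr.2⟩
  have e5 := (hy x).1 ⟨hxA.1, hxB.1⟩
  have e6 : s = x := e4.trans e5.symm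
  subst e6
  exact hxA.2 s1

theorem shell_nonempty {V : Type*} [DecidableEq V] (n : ℕ) (t : ℕ → Finset V)
    (h : IsClosedShell n t) (i j : ℕ) (hi : i < n) (hj : j < n) : (t i ∩ t j).Nonempty := by
  obtain ⟨h1, h2, h3⟩ := h
  rw [← Finset.card_pos]
  by_cases e : i = j
  · subst e; rw [Finset.inter_self, h1 i hi]; norm_num
  by_cases e1 : (i + 1) % n = j
  · subst e1; rw [h2 i hi]; norm_num
  by_cases e2 : (j + 1) % n = i
  · subst e2; rw [Finset.inter_comm, h2 j hj]; norm_num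
  rw [h3 i hi j hj e e1 e2]; norm_num

theorem succ_mod_cases (n i : ℕ) (hi : i < n) :
    (i + 1 < n ∧ (i + 1) % n = i + 1) ∨ (i + 1 = n ∧ (i + 1) % n = 0) := by
  rcases Nat.lt_or_ge (i + 1) n with h | h
  · exact Or.inl ⟨h, Nat.mod_eq_of_lt h⟩
  · have : i + 1 = n := by omega
    exact Or.inr ⟨this, by rw [this, Nat.mod_self]⟩

theorem pred_mod_cases (n i : ℕ) (hi : i < n) :
    (0 < i ∧ (i + n - 1) % n = i - 1) ∨ (i = 0 ∧ (i + n - 1) % n = n - 1) := by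
  rcases Nat.eq_zero_or_pos i with h | h
  · subst h
    exact Or.inr ⟨rfl, by rw [Nat.zero_add]; exact Nat.mod_eq_of_lt (by omega)⟩
  · refine Or.inl ⟨h, ?_⟩
    have : i + n - 1 = (i - 1) + n := by omega
    rw [this, Nat.add_mod_right]
    exact Nat.mod_eq_of_lt (by omega)

/-- In a closed `n`-shell with `n ≥ 4`, the structural vertices
`a 0, …, a (n-1)` are pairwise distinct, and so are `b 0, …, b (n-1)`,
where `a i` is the unique element of `t i \ t (i+1)` and `b i` the unique
element of `t i \ t (i-1)` (indices mod `n`). -/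
theorem closedShell_structural_vertices_distinct {V : Type*} [DecidableEq V]
    (n : ℕ) (hn : 4 ≤ n) (t : ℕ → Finset V) (hshell : IsClosedShell n t)
    (a b : ℕ → V)
    (ha : ∀ i < n, t i \ t ((i + 1) % n) = {a i})
    (hb : ∀ i < n, t i \ t ((i + n - 1) % n) = {b i}) :
    (∀ i < n, ∀ j < n, a i = a j → i = j) ∧
    (∀ i < n, ∀ j < n, b i = b j → i = j) := by
  have mem : ∀ {P Q : Finset V} {x : V}, P \ Q = {x} → x ∈ P ∧ x ∉ Q := by
    intro P Q x h
    rw [← Finset.mem_sdiff, h]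
    exact Finset.mem_singleton_self x
  have ne := shell_nonempty n t hshell
  obtain ⟨-, -, h3⟩ := hshell
  constructor
  · intro i hi j hj hij
    by_contra e
    have Ai := ha i hi
    have Aj := ha j hj
    rw [← hij] at Aj
    have e1 : (i + 1) % n ≠ j := by
      intro h; rw [h] at Ai; exact (mem Ai).2 (mem Aj).1
    have e2 : (j + 1) % n ≠ i := by
      intro h; rw [h] at Aj; exact (mem Aj).2 (mem Ai).1
    have li : (i + 1) % n < n := Nat.mod_lt _ (by omega)
    have lj : (j + 1) % n < n := Nat.mod_lt _ (by omega)
    have ci := succ_mod_cases n i hi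
    have cj := succ_mod_cases n j hj
    have cinext := succ_mod_cases n _ li
    have cjnext := succ_mod_cases n _ lj
    exact shell_local _ _ _ _ _ Ai Aj (h3 i hi j hj e e1 e2)
      (h3 _ li _ lj (by omega) (by omega) (by omega)) (ne _ _ li hj) (ne _ _ hi lj)
  · intro i hi j hj hij
    by_contra e
    have Ai := hb i hi
    have Aj := hb j hj
    rw [← hij] at Aj
    have e1 : (i + n - 1) % n ≠ j := by
      intro h; rw [h] at Ai; exact (mem Ai).2 (mem Aj).1
    have e2 : (j + n - 1) % n ≠ i := by
      intro h; rw [h] at Aj; exact (mem Aj).2 (mem Ai).1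
    have li : (i + n - 1) % n < n := Nat.mod_lt _ (by omega)
    have lj : (j + n - 1) % n < n := Nat.mod_lt _ (by omega)
    have ci := pred_mod_cases n i hi
    have cj := pred_mod_cases n j hj
    have di := succ_mod_cases n i hi
    have dj := succ_mod_cases n j hj
    have cinext := succ_mod_cases n _ li
    have cjnext := succ_mod_cases n _ lj
    exact shell_local _ _ _ _ _ Ai Aj (h3 i hi j hj e (by omega) (by omega))
      (h3 _ li _ lj (by omega) (by omega) (by omega)) (ne _ _ li hj) (ne _ _ hi lj)
end

section
/- Let t_0, …, t_{n−1} be a closed n-shell with n ≥ 5, with structural vertices a_i and b_i, and fix i (indices mod n). If b_{i+1} = a_{i+2}, then there exists a vertex x such that t_i = {a_i, a_{i+1}, x}, t_{i+1} = {a_{i+1}, a_{i+2}, x}, t_{i+2} = {a_{i+2}, b_{i+2}, x}, and t_{i+3} = {b_{i+2}, b_{i+3}, x}. -/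
theorem four_aux {V : Type*} [DecidableEq V] (A B C D : Finset V) (a0 a1 a2 b1 b2 b3 : V)
    (hB : B.card = 3) (h0 : A \ B = {a0}) (h1 : B \ C = {a1}) (h2 : C \ D = {a2})
    (k1 : B \ A = {b1}) (k2 : C \ B = {b2}) (k3 : D \ C = {b3}) (h : b1 = a2) :
    ∃ x : V, A = {a0, a1, x} ∧ B = {a1, a2, x} ∧ C = {a2, b2, x} ∧ D = {b2, b3, x} := by
  subst h
  simp only [Finset.ext_iff, Finset.mem_sdiff, Finset.mem_singleton] at h0 h1 h2 k1 k2 k3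
  have e1 : a1 ∈ B := ((h1 a1).2 rfl).1
  have e2 : b1 ∈ B := ((k1 b1).2 rfl).1
  have e3 : a1 ≠ b1 := by
    rintro rfl
    exact ((h1 a1).2 rfl).2 ((h2 a1).2 rfl).1
  have hc : ((B.erase a1).erase b1).card = 1 := by
    rw [Finset.card_erase_of_mem (Finset.mem_erase.2 ⟨e3.symm, e2⟩),
      Finset.card_erase_of_mem e1, hB]
  obtain ⟨x, hx⟩ := Finset.card_eq_one.1 hc
  simp only [Finset.ext_iff, Finset.mem_erase, Finset.mem_singleton] at hx
  refine ⟨x, ?_, ?_, ?_, ?_⟩ <;> ext v <;> simp only [Finset.mem_insert, Finset.mem_singleton] <;>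
    grind

/-- In a closed `n`-shell with `n ≥ 5`, if `b (i+1) = a (i+2)` (indices mod
`n`), then there is a vertex `x` with `t i = {a i, a (i+1), x}`,
`t (i+1) = {a (i+1), a (i+2), x}`, `t (i+2) = {a (i+2), b (i+2), x}` and
`t (i+3) = {b (i+2), b (i+3), x}`. -/
theorem closedShell_four_consecutive_case_a {V : Type*} [DecidableEq V]
    (n : ℕ) (hn : 5 ≤ n) (t : ℕ → Finset V) (hshell : IsClosedShell n t)
    (a b : ℕ → V)
    (ha : ∀ i < n, t i \ t ((i + 1) % n) = {a i})
    (hb : ∀ i < n, t i \ t ((i + n - 1) % n) = {b i}) :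
    ∀ i < n, b ((i + 1) % n) = a ((i + 2) % n) →
      ∃ x : V,
        t i = {a i, a ((i + 1) % n), x} ∧
        t ((i + 1) % n) = {a ((i + 1) % n), a ((i + 2) % n), x} ∧
        t ((i + 2) % n) = {a ((i + 2) % n), b ((i + 2) % n), x} ∧
        t ((i + 3) % n) = {b ((i + 2) % n), b ((i + 3) % n), x} := by
  intro i hi h
  have s : ∀ k, ((i + k) % n + 1) % n = (i + (k + 1)) % n := fun k => by
    rw [Nat.mod_add_mod, Nat.add_assoc]
  have p : ∀ k, ((i + (k + 1)) % n + n - 1) % n = (i + k) % n := fun k => by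
    rw [Nat.add_sub_assoc (by omega), Nat.mod_add_mod,
      show i + (k + 1) + (n - 1) = i + k + n by omega, Nat.add_mod_right]
  have l : ∀ k, (i + k) % n < n := fun k => Nat.mod_lt _ (by omega)
  have p0 : ((i + 1) % n + n - 1) % n = i := (p 0).trans (Nat.mod_eq_of_lt hi)
  have k1 := hb _ (l 1)
  have k2 := hb _ (l 2)
  have k3 := hb _ (l 3)
  have h1 := ha _ (l 1)
  have h2 := ha _ (l 2)
  rw [s] at h1 h2
  rw [p0] at k1
  rw [p 1] at k2
  rw [p 2] at k3
  exact four_aux _ _ _ _ _ _ _ _ _ _ (hshell.1 _ (l 1)) (ha i hi) h1 h2 k1 k2 k3 h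
end

section
/- Let t_0, …, t_{n−1} be a closed n-shell with n ≥ 5, with structural vertices a_i and b_i, and fix i (indices mod n). If a_i = b_{i+3}, then t_i = {a_i, a_{i+1}, a_{i+2}}, t_{i+1} = {a_{i+1}, b_{i+1}, a_{i+2}}, t_{i+2} = {b_{i+1}, b_{i+2}, a_{i+2}}, and t_{i+3} = {b_{i+2}, a_i, b_{i+1}}. -/
theorem eq_triple_aux {V : Type*} [DecidableEq V] {S : Finset V} (hS : S.card = 3) {x y z : V}
    (hx : x ∈ S) (hy : y ∈ S) (hz : z ∈ S) (hxy : x ≠ y) (hxz : x ≠ z) (hyz : y ≠ z) :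
    S = {x, y, z} := by
  symm
  apply Finset.eq_of_subset_of_card_le
  · intro w hw
    simp only [Finset.mem_insert, Finset.mem_singleton] at hw
    rcases hw with rfl | rfl | rfl <;> assumption
  · rw [hS, Finset.card_eq_three.mpr ⟨x, y, z, hxy, hxz, hyz, rfl⟩]

theorem four_sets_aux {V : Type*} [DecidableEq V] {A B C D : Finset V} {x a1 a2 b1 b2 : V}
    (cA : A.card = 3) (cB : B.card = 3) (cC : C.card = 3) (cD : D.card = 3)
    (cAB : (A ∩ B).card = 2) (cAC : (A ∩ C).card = 1) (cAD : (A ∩ D).card = 1)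
    (hA : A \ B = {x}) (hB : B \ C = {a1}) (hC : C \ D = {a2})
    (hB' : B \ A = {b1}) (hC' : C \ B = {b2}) (hD' : D \ C = {x}) :
    A = {x, a1, a2} ∧ B = {a1, b1, a2} ∧ C = {b1, b2, a2} ∧ D = {b2, x, b1} := by
  have m : ∀ {S T : Finset V} {u : V}, S \ T = {u} → ∀ w, (w ∈ S ∧ w ∉ T) ↔ w = u := by
    intro S T u h w
    rw [← Finset.mem_sdiff, h, Finset.mem_singleton]
  have mA := m hA
  have mB := m hB
  have mC := m hC
  have mB' := m hB'
  have mC' := m hC'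
  have mD' := m hD'
  obtain ⟨xA, xB⟩ := (mA x).2 rfl
  obtain ⟨a1B, a1C⟩ := (mB a1).2 rfl
  obtain ⟨a2C, a2D⟩ := (mC a2).2 rfl
  obtain ⟨b1B, b1A⟩ := (mB' b1).2 rfl
  obtain ⟨b2C, b2B⟩ := (mC' b2).2 rfl
  obtain ⟨xD, xC⟩ := (mD' x).2 rfl
  have a1A : a1 ∈ A := by
    by_contra h
    have e := (mB' a1).1 ⟨a1B, h⟩
    have hs : A ∩ B ⊆ A ∩ C := by
      intro w hw
      rw [Finset.mem_inter] at hw ⊢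
      refine ⟨hw.1, ?_⟩
      by_contra hc
      have := (mB w).1 ⟨hw.2, hc⟩
      exact h (this ▸ hw.1)
    have := Finset.card_le_card hs
    omega
  have b1C : b1 ∈ C := by
    by_contra h
    have e := (mB b1).1 ⟨b1B, h⟩
    exact b1A (e ▸ a1A)
  have a2A : a2 ∈ A := by
    obtain ⟨q, hq⟩ := Finset.card_eq_one.1 cAC
    have hq' : q ∈ A ∩ C := by rw [hq]; exact Finset.mem_singleton_self q
    rw [Finset.mem_inter] at hq'
    have qD : q ∉ D := by
      intro h
      have e := Finset.card_le_one.1 cAD.le q (Finset.mem_inter.2 ⟨hq'.1, h⟩) x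
        (Finset.mem_inter.2 ⟨xA, xD⟩)
      exact xC (e ▸ hq'.2)
    have e := (mC q).1 ⟨hq'.2, qD⟩
    exact e ▸ hq'.1
  have a2B : a2 ∈ B := by
    by_contra h
    have e := (mA a2).1 ⟨a2A, h⟩
    exact xC (e ▸ a2C)
  have b1D : b1 ∈ D := by
    by_contra h
    have e := (mC b1).1 ⟨b1C, h⟩
    exact b1A (e ▸ a2A)
  have b2D : b2 ∈ D := by
    by_contra h
    have e := (mC b2).1 ⟨b2C, h⟩
    exact b2B (e ▸ a2B)
  have ne : ∀ {S : Finset V} {u v : V}, u ∈ S → v ∉ S → u ≠ v := by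
    intro S u v hu hv e
    exact hv (e ▸ hu)
  exact ⟨eq_triple_aux cA xA a1A a2A (ne a1B xB).symm (ne a2B xB).symm (ne a2C a1C).symm,
    eq_triple_aux cB a1B b1B a2B (ne a1A b1A) (ne a2C a1C).symm (ne a2A b1A).symm,
    eq_triple_aux cC b1C b2C a2C (ne b1B b2B) (ne a2A b1A).symm (ne a2B b2B).symm,
    eq_triple_aux cD b2D xD b1D (ne b2C xC) (ne b1B b2B).symm (ne b1C xC).symm⟩

theorem mod_cases_aux (n i k : ℕ) (hi : i < n) (hk : k < n) :
    (i + k < n ∧ (i + k) % n = i + k) ∨ (n ≤ i + k ∧ (i + k) % n = i + k - n) := by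
  rcases lt_or_ge (i + k) n with h | h
  · exact Or.inl ⟨h, Nat.mod_eq_of_lt h⟩
  · refine Or.inr ⟨h, ?_⟩
    rw [Nat.mod_eq_sub_mod h, Nat.mod_eq_of_lt (by omega)]

theorem shell_nonadj_aux {V : Type*} [DecidableEq V] {n : ℕ} (hn : 5 ≤ n) {t : ℕ → Finset V}
    (hshell : IsClosedShell n t) {i k : ℕ} (hi : i < n) (hk : k = 2 ∨ k = 3) :
    (t i ∩ t ((i + k) % n)).card = 1 := by
  have hj : (i + k) % n < n := Nat.mod_lt _ (by omega)
  have h1 := mod_cases_aux n i k hi (by omega)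
  have h2 := mod_cases_aux n i 1 hi (by omega)
  have h3 := mod_cases_aux n ((i + k) % n) 1 hj (by omega)
  apply hshell.2.2 i hi _ hj <;> omega

/-- In a closed `n`-shell with `n ≥ 5`, if `a i = b (i+3)` (indices mod `n`),
then `t i = {a i, a (i+1), a (i+2)}`, `t (i+1) = {a (i+1), b (i+1), a (i+2)}`,
`t (i+2) = {b (i+1), b (i+2), a (i+2)}` and `t (i+3) = {b (i+2), a i, b (i+1)}`. -/
theorem closedShell_four_consecutive_case_b {V : Type*} [DecidableEq V]
    (n : ℕ) (hn : 5 ≤ n) (t : ℕ → Finset V) (hshell : IsClosedShell n t)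
    (a b : ℕ → V)
    (ha : ∀ i < n, t i \ t ((i + 1) % n) = {a i})
    (hb : ∀ i < n, t i \ t ((i + n - 1) % n) = {b i}) :
    ∀ i < n, a i = b ((i + 3) % n) →
      t i = {a i, a ((i + 1) % n), a ((i + 2) % n)} ∧
      t ((i + 1) % n) = {a ((i + 1) % n), b ((i + 1) % n), a ((i + 2) % n)} ∧
      t ((i + 2) % n) = {b ((i + 1) % n), b ((i + 2) % n), a ((i + 2) % n)} ∧
      t ((i + 3) % n) = {b ((i + 2) % n), a i, b ((i + 1) % n)} := by
  intro i hi hab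
  have pos : 0 < n := by omega
  have l : ∀ k, (i + k) % n < n := fun k => Nat.mod_lt _ pos
  have s : ∀ k, ((i + k) % n + 1) % n = (i + (k + 1)) % n := by
    intro k
    rw [Nat.mod_add_mod, Nat.add_assoc]
  have p : ∀ k, ((i + (k + 1)) % n + n - 1) % n = (i + k) % n := by
    intro k
    have e : (i + (k + 1)) % n + n - 1 = (i + (k + 1)) % n + (n - 1) := by omega
    rw [e, Nat.mod_add_mod]
    have e' : i + (k + 1) + (n - 1) = i + k + n := by omega
    rw [e', Nat.add_mod_right]
  have hB := ha _ (l 1)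
  have hC := ha _ (l 2)
  have hB' := hb _ (l 1)
  have hC' := hb _ (l 2)
  have hD' := hb _ (l 3)
  rw [s] at hB hC
  rw [p 0, show (i + 0) % n = i from Nat.mod_eq_of_lt hi] at hB'
  rw [p 1] at hC'
  rw [p 2, ← hab] at hD'
  exact four_sets_aux (hshell.1 _ hi) (hshell.1 _ (l 1)) (hshell.1 _ (l 2)) (hshell.1 _ (l 3))
    (hshell.2.1 _ hi) (shell_nonadj_aux hn hshell hi (Or.inl rfl))
    (shell_nonadj_aux hn hshell hi (Or.inr rfl)) (ha _ hi) hB hC hB' hC' hD'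
end

section
/- Let t_0, …, t_{n−1} be an open n-shell with n ≥ 5, with structural vertices a_i and b_i. If b_1 = a_2 and b_2 = a_3, then b_i = a_{i+1} for all i with 1 ≤ i ≤ n−3. -/
/-- An open `n`-shell: a family `t 0, …, t (n-1)` of 3-element subsets of the
vertex type `V` such that consecutive triangles share exactly two vertices and
non-consecutive triangles share exactly one vertex. -/
def IsOpenShell {V : Type*} [DecidableEq V] (n : ℕ) (t : ℕ → Finset V) : Prop :=
  (∀ i < n, (t i).card = 3) ∧
  (∀ i, i + 1 < n → (t i ∩ t (i + 1)).card = 2) ∧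
  (∀ i j, j < n → i + 2 ≤ j → (t i ∩ t j).card = 1)

/-- In an open `n`-shell with `n ≥ 5`, with structural vertices `a i` (the
unique element of `t i \ t (i+1)`, for `i ≤ n-2`) and `b i` (the unique
element of `t i \ t (i-1)`, for `1 ≤ i ≤ n-1`): if `b 1 = a 2` and
`b 2 = a 3`, then `b i = a (i+1)` for all `1 ≤ i ≤ n-3`. -/
theorem openShell_repetition_pattern_a {V : Type*} [DecidableEq V]
    (n : ℕ) (hn : 5 ≤ n) (t : ℕ → Finset V) (hshell : IsOpenShell n t)
    (a b : ℕ → V)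
    (ha : ∀ i, i + 1 < n → t i \ t (i + 1) = {a i})
    (hb : ∀ i, 1 ≤ i → i < n → t i \ t (i - 1) = {b i})
    (h1 : b 1 = a 2) (h2 : b 2 = a 3) :
    ∀ i, 1 ≤ i → i ≤ n - 3 → b i = a (i + 1) := by
  obtain ⟨-, hc2, hc1⟩ := hshell
  -- membership facts
  have haout : ∀ i x, i + 1 < n → x ∈ t i → x ∉ t (i + 1) → x = a i := by
    intro i x hi hx hx'
    have : x ∈ t i \ t (i + 1) := Finset.mem_sdiff.2 ⟨hx, hx'⟩
    rw [ha i hi] at this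
    simpa using this
  have hbout : ∀ i x, i + 1 < n → x ∈ t (i + 1) → x ∉ t i → x = b (i + 1) := by
    intro i x hi hx hx'
    have : x ∈ t (i + 1) \ t (i + 1 - 1) := Finset.mem_sdiff.2 ⟨hx, hx'⟩
    rw [hb (i + 1) (by omega) hi] at this
    simpa using this
  have hbmem : ∀ i, i + 1 < n → b (i + 1) ∈ t (i + 1) ∧ b (i + 1) ∉ t i := by
    intro i hi
    have : b (i + 1) ∈ t (i + 1) \ t (i + 1 - 1) := by
      rw [hb (i + 1) (by omega) hi]; simp
    simpa using this
  have huniq : ∀ i j x y, j < n → i + 2 ≤ j → x ∈ t i → x ∈ t j → y ∈ t i → y ∈ t j → x = y := by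
    intro i j x y hj hij h1 h2 h3 h4
    exact Finset.card_le_one.1 (hc1 i j hj hij).le x (Finset.mem_inter.2 ⟨h1, h2⟩) y
      (Finset.mem_inter.2 ⟨h3, h4⟩)
  -- the common vertex
  obtain ⟨p, hp, hpa⟩ : ∃ p ∈ t 0 ∩ t 1, p ≠ a 1 :=
    Finset.exists_mem_ne (by rw [hc2 0 (by omega)]; norm_num) (a 1)
  obtain ⟨hp0, hp1⟩ := Finset.mem_inter.1 hp
  have hp2 : p ∈ t 2 := by
    by_contra h
    exact hpa (haout 1 p (by omega) hp1 h)
  have hpall : ∀ m, m + 2 < n → (∀ i, 1 ≤ i → i + 1 ≤ m + 1 → b i = a (i + 1)) →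
      ∀ j, j ≤ m → p ∈ t j ∧ p ∈ t (j + 1) ∧ p ∈ t (j + 2) := by
    intro m hm hm' j
    induction j with
    | zero => intro _; exact ⟨hp0, hp1, hp2⟩
    | succ j ih =>
      intro hj
      obtain ⟨q0, q1, q2⟩ := ih (by omega)
      refine ⟨q1, q2, ?_⟩
      by_contra h
      have e := haout (j + 2) p (by omega) q2 h
      have e' := hm' (j + 1) (by omega) (by omega)
      have := (hbmem j (by omega)).2
      rw [e', ← e] at this
      exact this q0
  intro i
  induction i using Nat.strong_induction_on with
  | _ i ih =>
  intro hi1 hin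
  by_cases hi : i ≤ 2
  · interval_cases i
    · exact h1
    · exact h2
  obtain ⟨k, rfl⟩ : ∃ k, i = k + 3 := ⟨i - 3, by omega⟩
  have hP : ∀ j, j ≤ k + 2 → p ∈ t j ∧ p ∈ t (j + 1) ∧ p ∈ t (j + 2) :=
    hpall (k + 2) (by omega) (fun i h h' => ih i (by omega) h (by omega))
  by_contra hne
  obtain ⟨hB, hB'⟩ := hbmem (k + 2) (by omega)
  have hB4 : b (k + 3) ∈ t (k + 4) := by
    by_contra h
    have e := haout (k + 3) _ (by omega) hB h
    have e' := ih (k + 2) (by omega) (by omega) (by omega)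
    rw [← e'] at e
    have := (hbmem (k + 1) (by omega)).1
    exact hB' (e ▸ this)
  have hB5 : b (k + 3) ∈ t (k + 5) := by
    by_contra h
    exact hne (haout (k + 4) _ (by omega) hB4 h)
  have hp5 : p ∉ t (k + 5) := by
    intro h
    have := huniq (k + 3) (k + 5) p (b (k + 3)) (by omega) (by omega)
      (hP (k + 2) le_rfl).2.1 h hB hB5
    exact hB' (this ▸ (hP (k + 2) le_rfl).1)
  have key : ∀ j, j ≤ k + 2 → b (k + 5) ∈ t j := by
    intro j hj
    obtain ⟨x, hx⟩ := Finset.card_pos.1 (by rw [hc1 j (k + 5) (by omega) (by omega)]; norm_num :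
      0 < (t j ∩ t (k + 5)).card)
    obtain ⟨hxj, hx5⟩ := Finset.mem_inter.1 hx
    have hx4 : x ∉ t (k + 4) := by
      intro h
      have := huniq j (k + 4) x p (by omega) (by omega) hxj h (hP j hj).1 (hP (k + 2) le_rfl).2.2
      exact hp5 (this ▸ hx5)
    exact (hbout (k + 4) x (by omega) hx5 hx4) ▸ hxj
  have := huniq 0 2 p (b (k + 5)) (by omega) (by omega) hp0 hp2 (key 0 (by omega))
    (key 2 (by omega))
  exact hp5 (this ▸ (hbmem (k + 4) (by omega)).1)
end

section
/- Let t_0, …, t_{n−1} be an open n-shell with n ≥ 5, with structural vertices a_i and b_i. If b_1 = a_2 and a_1 = b_4, then n ≤ 6, and if n = 6 then moreover b_3 = a_4. -/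
/-- A three-element set written as a triple has distinct entries. -/
lemma triple_distinct {V : Type*} [DecidableEq V] {x y z : V}
    (h : ({x, y, z} : Finset V).card = 3) : x ≠ y ∧ x ≠ z ∧ y ≠ z := by
  refine ⟨?_, ?_, ?_⟩ <;> rintro rfl
  · have := Finset.card_le_two (a := x) (b := z); simp at h; omega
  · have := Finset.card_le_two (a := x) (b := y)
    rw [Finset.insert_eq_of_mem (by simp)] at h
    have := Finset.card_le_two (a := y) (b := x); omega
  · have := Finset.card_le_two (a := x) (b := y); simp at h; omega

/-- Passing from a triangle to an adjacent one replaces exactly one vertex. -/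
lemma shell_step {V : Type*} [DecidableEq V] {s t : Finset V} {x y z : V}
    (hs : s = {x, y, z}) (hs3 : s.card = 3) (ht : t.card = 3) (h : (s ∩ t).card = 2) :
    ∃ w, w ∉ s ∧ (t = {y, z, w} ∨ t = {x, z, w} ∨ t = {x, y, w}) := by
  have h1 : (t \ s).card = 1 := by
    have := Finset.card_sdiff_add_card_inter t s
    rw [Finset.inter_comm] at this; omega
  have h2 : (s \ t).card = 1 := by
    have := Finset.card_sdiff_add_card_inter s t
    omega
  obtain ⟨w, hw⟩ := Finset.card_eq_one.1 h1
  obtain ⟨v, hv⟩ := Finset.card_eq_one.1 h2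
  have hw' : ∀ u, (u ∈ t ∧ u ∉ s) ↔ u = w := fun u => by
    rw [← Finset.mem_sdiff, hw, Finset.mem_singleton]
  have hv' : ∀ u, (u ∈ s ∧ u ∉ t) ↔ u = v := fun u => by
    rw [← Finset.mem_sdiff, hv, Finset.mem_singleton]
  have hd : x ≠ y ∧ x ≠ z ∧ y ≠ z := by
    rw [hs] at hs3; exact triple_distinct hs3
  have hsm : ∀ u, u ∈ s ↔ u = x ∨ u = y ∨ u = z := fun u => by simp [hs]
  have hvs := (hsm v).1 ((hv' v).2 rfl).1
  refine ⟨w, ((hw' w).2 rfl).2, ?_⟩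
  rcases hvs with rfl | rfl | rfl
  · left; ext u; have := hw' u; have := hv' u; have := hsm u; simp; grind
  · right; left; ext u; have := hw' u; have := hv' u; have := hsm u; simp; grind
  · right; right; ext u; have := hw' u; have := hv' u; have := hsm u; simp; grind

theorem openShell_repetition_pattern_b {V : Type*} [DecidableEq V]
    (n : ℕ) (hn : 5 ≤ n) (t : ℕ → Finset V) (hshell : IsOpenShell n t)
    (a b : ℕ → V)
    (ha : ∀ i, i + 1 < n → t i \ t (i + 1) = {a i})
    (hb : ∀ i, 1 ≤ i → i < n → t i \ t (i - 1) = {b i})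
    (h1 : b 1 = a 2) (h2 : a 1 = b 4) :
    n ≤ 6 ∧ (n = 6 → b 3 = a 4) := by
  obtain ⟨c3, c2, c1⟩ := hshell
  have ha' : ∀ i, i + 1 < n → ∀ u, (u ∈ t i ∧ u ∉ t (i+1)) ↔ u = a i := fun i hi u => by
    rw [← Finset.mem_sdiff, ha i hi, Finset.mem_singleton]
  have hb' : ∀ i, i + 1 < n → ∀ u, (u ∈ t (i+1) ∧ u ∉ t i) ↔ u = b (i+1) := fun i hi u => by
    have := hb (i+1) (by omega) hi
    rw [Nat.add_sub_cancel] at this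
    rw [← Finset.mem_sdiff, this, Finset.mem_singleton]
  have uq : ∀ i j, j < n → i + 2 ≤ j → ∀ u v, u ∈ t i → u ∈ t j → v ∈ t i → v ∈ t j → u = v := by
    intro i j hj hij u v p q r s
    exact Finset.card_le_one.1 (c1 i j hj hij).le u (Finset.mem_inter.2 ⟨p, q⟩) v
      (Finset.mem_inter.2 ⟨r, s⟩)
  have ex : ∀ i j, j < n → i + 2 ≤ j → ∃ u, u ∈ t i ∧ u ∈ t j := by
    intro i j hj hij
    obtain ⟨u, hu⟩ := Finset.card_pos.1 (by rw [c1 i j hj hij]; omega : 0 < (t i ∩ t j).card)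
    exact ⟨u, Finset.mem_inter.1 hu⟩
  have dist : ∀ i < n, ∀ x y z, t i = {x, y, z} → x ≠ y ∧ x ≠ z ∧ y ≠ z := by
    intro i hi x y z h
    have := c3 i hi
    rw [h] at this; exact triple_distinct this
  have st : ∀ i, i + 1 < n → ∀ x y z, t i = {x, y, z} → ∃ w, w ∉ t i ∧
      (t (i+1) = {y, z, w} ∨ t (i+1) = {x, z, w} ∨ t (i+1) = {x, y, w}) :=
    fun i hi x y z h => shell_step h (c3 i (by omega)) (c3 _ hi) (c2 i hi)
  -- The triangle `t 2 = {q, b 1, w}`, and the determination of `t 0, …, t 4`.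
  have mem1 := (ha' 1 (by omega) (a 1)).2 rfl
  have memb1 := (hb' 0 (by omega) (b 1)).2 rfl
  have mem2 := (ha' 2 (by omega) (a 2)).2 rfl
  have mem4 := (hb' 3 (by omega) (b 4)).2 rfl
  simp only [zero_add, Nat.reduceAdd] at mem1 memb1 mem2 mem4
  rw [← h1] at mem2
  rw [← h2] at mem4
  generalize hA : a 1 = A at *
  generalize hB : b 1 = B at *
  have hAB : A ≠ B := by rintro rfl; exact mem1.2 mem2.1
  obtain ⟨q, hq⟩ : ∃ q, t 1 = {A, B, q} := by
    have hsub : ({A, B} : Finset V) ⊆ t 1 := by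
      intro u hu; simp at hu; rcases hu with rfl | rfl
      exacts [mem1.1, memb1.1]
    have hc : (t 1 \ {A, B}).card = 1 := by
      rw [Finset.card_sdiff_of_subset hsub, c3 1 (by omega), Finset.card_pair hAB]
    obtain ⟨q, hq⟩ := Finset.card_eq_one.1 hc
    refine ⟨q, ?_⟩
    have := Finset.sdiff_union_of_subset hsub
    rw [← this, hq]; ext u; simp; tauto
  have d1 := dist 1 (by omega) _ _ _ hq
  have m1 : ∀ u, u ∈ t 1 ↔ u = A ∨ u = B ∨ u = q := fun u => by simp [hq]
  obtain ⟨w, hw, h2'⟩ := st 1 (by omega) _ _ _ hq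
  have e2 : t 2 = {B, q, w} := by
    rcases h2' with h | h | h
    · exact h
    · exact absurd (by simp [h]) mem1.2
    · exact absurd (by simp [h]) mem1.2
  have m2 : ∀ u, u ∈ t 2 ↔ u = B ∨ u = q ∨ u = w := fun u => by simp [e2]
  have m0 : A ∈ t 0 ∧ q ∈ t 0 := by
    have := hb' 0 (by omega)
    have hA0 := this A
    have hq0 := this q
    simp only [zero_add] at hA0 hq0
    grind
  obtain ⟨x, hx, h3'⟩ := st 2 (by omega) _ _ _ e2
  have e3 : t 3 = {q, w, x} := by
    rcases h3' with h | h | h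
    · exact h
    · exact absurd (by simp [h]) mem2.2
    · exact absurd (by simp [h]) mem2.2
  have m3 : ∀ u, u ∈ t 3 ↔ u = q ∨ u = w ∨ u = x := fun u => by simp [e3]
  have d2 := dist 2 (by omega) _ _ _ e2
  have d3 := dist 3 (by omega) _ _ _ e3
  obtain ⟨y, hy, h4'⟩ := st 3 (by omega) _ _ _ e3
  have u13 := uq 1 3 (by omega) (by omega)
  have u14 := uq 1 4 (by omega) (by omega)
  have u24 := uq 2 4 (by omega) (by omega)
  have e4 : t 4 = {w, x, A} := by
    have hyA : y = A := by
      have := mem4.1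
      rcases h4' with h | h | h <;> rw [h] at this <;> simp at this <;> grind
    subst hyA
    rcases h4' with h | h | h
    · exact h
    · exact absurd (u14 y q mem1.1 (by simp [h]) (by simp [hq]) (by simp [h])) d1.2.1
    · exact absurd (u14 y q mem1.1 (by simp [h]) (by simp [hq]) (by simp [h])) d1.2.1
  have m4 : ∀ u, u ∈ t 4 ↔ u = w ∨ u = x ∨ u = A := fun u => by simp [e4]
  have d4 := dist 4 (by omega) _ _ _ e4
  have bx : b 3 = x := by
    have := hb' 2 (by omega) x
    simp only [Nat.reduceAdd] at this
    exact (this.1 ⟨by simp [e3], hx⟩).symm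
  by_cases h5n : n = 5
  · omega
  obtain ⟨z, hz, h5'⟩ := st 4 (by omega) _ _ _ e4
  simp only [Nat.reduceAdd] at h5'
  have e5 : t 5 = {w, A, z} := by
    have u35 := uq 3 5 (by omega) (by omega) w x
    have u15 := uq 1 5 (by omega) (by omega) A
    obtain ⟨v, hv2, hv5⟩ := ex 2 5 (by omega) (by omega)
    rcases h5' with h | h | h
    · have m5 : ∀ u, u ∈ t 5 ↔ u = x ∨ u = A ∨ u = z := fun u => by simp [h]
      have := u15 v
      exfalso; clear ha hb c3 c2 c1 ha' hb' uq ex dist st h2' h3' h4' e2 e3 e4 hq h u13 u14 u24 h1 h2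
      grind
    · exact h
    · have m5 : ∀ u, u ∈ t 5 ↔ u = w ∨ u = x ∨ u = z := fun u => by simp [h]
      exfalso; clear ha hb c3 c2 c1 ha' hb' uq ex dist st h2' h3' h4' e2 e3 e4 hq h u13 u14 u24 h1 h2
      grind
  have d5 := dist 5 (by omega) _ _ _ e5
  have m5 : ∀ u, u ∈ t 5 ↔ u = w ∨ u = A ∨ u = z := fun u => by simp [e5]
  have ax : a 4 = x := by
    have := ha' 4 (by omega) x
    simp only [Nat.reduceAdd] at this
    exact (this.1 (by grind)).symm
  refine ⟨?_, fun _ => by rw [bx, ax]⟩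
  by_contra h6
  obtain ⟨r, hr, h6'⟩ := st 5 (by omega) _ _ _ e5
  simp only [Nat.reduceAdd] at h6'
  have u46 := uq 4 6 (by omega) (by omega) w A
  have u16 := uq 1 6 (by omega) (by omega) A
  have u26 := uq 2 6 (by omega) (by omega) w
  obtain ⟨v, hv2, hv6⟩ := ex 2 6 (by omega) (by omega)
  obtain ⟨v', hv1', hv6'⟩ := ex 1 6 (by omega) (by omega)
  have u16v := u16 v
  have u26v := u26 v'
  have u15v := uq 1 5 (by omega) (by omega) A z
  have u25v := uq 2 5 (by omega) (by omega) w z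
  rcases h6' with h | h | h
  · have m6 : ∀ u, u ∈ t 6 ↔ u = A ∨ u = z ∨ u = r := fun u => by simp [h]
    clear ha hb c3 c2 c1 ha' hb' uq ex dist st h2' h3' h4' h5' e2 e3 e4 e5 hq h u13 u14 u24 h1 h2
    grind
  · have m6 : ∀ u, u ∈ t 6 ↔ u = w ∨ u = z ∨ u = r := fun u => by simp [h]
    clear ha hb c3 c2 c1 ha' hb' uq ex dist st h2' h3' h4' h5' e2 e3 e4 e5 hq h u13 u14 u24 h1 h2
    grind
  · have m6 : ∀ u, u ∈ t 6 ↔ u = w ∨ u = A ∨ u = r := fun u => by simp [h]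
    clear ha hb c3 c2 c1 ha' hb' uq ex dist st h2' h3' h4' h5' e2 e3 e4 e5 hq h u13 u14 u24 h1 h2
    grind
end

section
/- There is no open n-shell with n ≥ 5 whose structural vertices satisfy both a_0 = b_3 and a_1 = b_4. -/
/-- There is no open `n`-shell with `n ≥ 5` whose structural vertices satisfy
both `a 0 = b 3` and `a 1 = b 4`, where `a i` is the unique element of
`t i \ t (i+1)` and `b i` the unique element of `t i \ t (i-1)`. -/
theorem openShell_repetition_pattern_d {V : Type*} [DecidableEq V]
    (n : ℕ) (hn : 5 ≤ n) (t : ℕ → Finset V) (hshell : IsOpenShell n t)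
    (a b : ℕ → V)
    (ha : ∀ i, i + 1 < n → t i \ t (i + 1) = {a i})
    (hb : ∀ i, 1 ≤ i → i < n → t i \ t (i - 1) = {b i}) :
    ¬ (a 0 = b 3 ∧ a 1 = b 4) := by
  rintro ⟨h1, h2⟩
  obtain ⟨-, hc2, hc1⟩ := hshell
  have A : ∀ i, i + 1 < n → ∀ v, (v ∈ t i ∧ v ∉ t (i + 1)) ↔ v = a i := by
    intro i hi v
    rw [← Finset.mem_sdiff, ha i hi, Finset.mem_singleton]
  have B : ∀ i, i + 1 < n → ∀ v, (v ∈ t (i + 1) ∧ v ∉ t i) ↔ v = b (i + 1) := by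
    intro i hi v
    have h := hb (i + 1) (by omega) hi
    rw [Nat.add_sub_cancel] at h
    rw [← Finset.mem_sdiff, h, Finset.mem_singleton]
  have U : ∀ i j, j < n → i + 2 ≤ j → ∀ u v, u ∈ t i → u ∈ t j → v ∈ t i → v ∈ t j → u = v := by
    intro i j hj hij u v hu hu' hv hv'
    exact Finset.card_le_one.mp (hc1 i j hj hij).le u (Finset.mem_inter.2 ⟨hu, hu'⟩) v
      (Finset.mem_inter.2 ⟨hv, hv'⟩)
  obtain ⟨q, hq⟩ := Finset.card_pos.mp (by rw [hc1 0 2 (by omega) (by omega)]; omega)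
  obtain ⟨hq0, hq2⟩ := Finset.mem_inter.1 hq
  obtain ⟨u, hu, v, hv, huv⟩ := Finset.one_lt_card.mp
    (show 1 < (t 1 ∩ t 2).card by rw [hc2 1 (by omega)]; omega)
  obtain ⟨hu1, hu2⟩ := Finset.mem_inter.1 hu
  obtain ⟨hv1, hv2⟩ := Finset.mem_inter.1 hv
  have A0 := A 0 (by omega)
  have A1 := A 1 (by omega)
  have A2 := A 2 (by omega)
  have A3 := A 3 (by omega)
  have B0 := B 0 (by omega)
  have B2 := B 2 (by omega)
  have B3 := B 3 (by omega)
  have U02 := U 0 2 (by omega) (by omega)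
  have U03 := U 0 3 (by omega) (by omega)
  have U04 := U 0 4 (by omega) (by omega)
  have U14 := U 1 4 (by omega) (by omega)
  simp only [Nat.reduceAdd, zero_add] at A0 A1 A2 A3 B0 B2 B3
  obtain ⟨x0, x1⟩ := (A0 _).2 rfl
  obtain ⟨y1, y2⟩ := (A1 _).2 rfl
  obtain ⟨x3, x2⟩ := (B2 _).2 h1
  obtain ⟨y4, y3⟩ := (B3 _).2 h2
  obtain ⟨c1, c0⟩ := (B0 _).2 rfl
  have hcy : b 1 ≠ a 1 := by
    intro h
    have hu0 : u ∈ t 0 := by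
      by_contra hn0
      exact y2 (h ▸ ((B0 u).1 ⟨hu1, hn0⟩) ▸ hu2)
    have hv0 : v ∈ t 0 := by
      by_contra hn0
      exact y2 (h ▸ ((B0 v).1 ⟨hv1, hn0⟩) ▸ hv2)
    exact huv (U02 u v hu0 hu2 hv0 hv2)
  have y0 : a 1 ∈ t 0 := by
    by_contra hn0
    exact hcy ((B0 _).1 ⟨y1, hn0⟩).symm
  have c2 : b 1 ∈ t 2 := by
    by_contra hn0
    exact hcy ((A1 _).1 ⟨c1, hn0⟩)
  have c3 : b 1 ∈ t 3 := by
    by_contra hn0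
    have e := (A2 _).1 ⟨c2, hn0⟩
    have q3 : q ∈ t 3 := by
      by_contra hn1
      have e' := (A2 _).1 ⟨hq2, hn1⟩
      exact c0 (by rw [e, ← e']; exact hq0)
    have := U03 q (a 0) hq0 q3 x0 x3
    exact x2 (this ▸ hq2)
  have c4 : b 1 ∈ t 4 := by
    by_contra hn0
    have e := (A3 _).1 ⟨c3, hn0⟩
    have x4 : a 0 ∈ t 4 := by
      by_contra hn1
      have e' := (A3 _).1 ⟨x3, hn1⟩
      exact x1 (by rw [e', ← e]; exact c1)
    have := U04 (a 0) (a 1) x0 x4 y0 y4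
    exact x1 (this ▸ y1)
  exact hcy (U14 _ _ c1 c4 y1 y4)
end

section
/- Let t_0, …, t_{n−1} be a closed n-shell with n ≥ 4, with structural vertices a_i and b_i. If b_i = a_{(i+1) mod n} for all i, then there exists a vertex x, distinct from all the a_i, such that t_i = {a_i, a_{(i+1) mod n}, x} for all i; that is, the shell is the cone triangulation of a disk over the n-cycle a_0, …, a_{n−1}. -/
/-- In a closed `n`-shell with `n ≥ 4`, with structural vertices `a i` (the
unique element of `t i \ t (i+1)`) and `b i` (the unique element of
`t i \ t (i-1)`, indices mod `n`): if `b i = a ((i+1) % n)` for all `i`, then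
there is a vertex `x`, distinct from all the `a i`, such that
`t i = {a i, a ((i+1) % n), x}` for all `i`; i.e. the shell is the cone
triangulation of a disk over the `n`-cycle `a 0, …, a (n-1)`. -/
theorem closedShell_cone_disk {V : Type*} [DecidableEq V]
    (n : ℕ) (hn : 4 ≤ n) (t : ℕ → Finset V) (hshell : IsClosedShell n t)
    (a b : ℕ → V)
    (ha : ∀ i < n, t i \ t ((i + 1) % n) = {a i})
    (hb : ∀ i < n, t i \ t ((i + n - 1) % n) = {b i})
    (hrep : ∀ i < n, b i = a ((i + 1) % n)) :
    ∃ x : V, (∀ i < n, x ≠ a i) ∧ ∀ i < n, t i = {a i, a ((i + 1) % n), x} := by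
  obtain ⟨hc, -, -⟩ := hshell
  have hmem : ∀ i < n, a i ∈ t i ∧ a i ∉ t ((i + 1) % n) := by
    intro i hi
    have h : a i ∈ t i \ t ((i + 1) % n) := by rw [ha i hi]; simp
    simpa using h
  have hlt : ∀ i, (i + 1) % n < n := fun i => Nat.mod_lt _ (by omega)
  have hbm : ∀ i < n, a ((i + 1) % n) ∈ t i ∧ a ((i + 1) % n) ∉ t ((i + n - 1) % n) := by
    intro i hi
    have h : b i ∈ t i \ t ((i + n - 1) % n) := by rw [hb i hi]; simp
    rw [hrep i hi] at h
    simpa using h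
  have hne : ∀ i < n, a i ≠ a ((i + 1) % n) := by
    intro i hi h
    apply (hmem i hi).2
    rw [h]
    exact (hmem _ (hlt i)).1
  have h0 : 0 < n := by omega
  obtain ⟨x, hx, hx'⟩ : ∃ x ∈ t 0, x ∉ ({a 0, a ((0 + 1) % n)} : Finset V) := by
    apply Finset.exists_mem_notMem_of_card_lt_card
    rw [hc 0 h0]
    exact lt_of_le_of_lt Finset.card_le_two (by norm_num)
  have key : ∀ i, i < n → x ∈ t i ∧ x ≠ a i ∧ x ≠ a ((i + 1) % n) := by
    intro i
    induction i with
    | zero =>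
      intro _
      simp only [Finset.mem_insert, Finset.mem_singleton, not_or] at hx'
      exact ⟨hx, hx'.1, hx'.2⟩
    | succ i ih =>
      intro hi
      have hi' : i < n := by omega
      obtain ⟨h1, h2, h3⟩ := ih hi'
      have e : (i + 1) % n = i + 1 := Nat.mod_eq_of_lt hi
      have e2 : (i + 1 + n - 1) % n = i := by
        rw [show i + 1 + n - 1 = i + n by omega, Nat.add_mod_right, Nat.mod_eq_of_lt hi']
      refine ⟨?_, ?_, ?_⟩
      · by_contra hnot
        have h : x ∈ t i \ t ((i + 1) % n) := by
          rw [e]; exact Finset.mem_sdiff.2 ⟨h1, hnot⟩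
        rw [ha i hi'] at h
        exact h2 (Finset.mem_singleton.1 h)
      · rwa [e] at h3
      · intro h
        have h4 := (hbm (i + 1) hi).2
        rw [e2, ← h] at h4
        exact h4 h1
  refine ⟨x, fun i hi => (key i hi).2.1, fun i hi => ?_⟩
  obtain ⟨h1, h2, h3⟩ := key i hi
  symm
  apply Finset.eq_of_subset_of_card_le
  · intro y hy
    simp only [Finset.mem_insert, Finset.mem_singleton] at hy
    rcases hy with rfl | rfl | rfl
    · exact (hmem i hi).1
    · exact (hbm i hi).1
    · exact h1
  · rw [hc i hi, Finset.card_eq_three.2 ⟨_, _, _, hne i hi, h2.symm, h3.symm, rfl⟩]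
end

section
/- There is no closed 5-shell t_0, …, t_4 whose structural vertices satisfy both b_1 = a_2 and a_1 = b_4. -/
/-- There is no closed 5-shell whose structural vertices satisfy both
`b 1 = a 2` and `a 1 = b 4`, where `a i` is the unique element of
`t i \ t (i+1)` and `b i` the unique element of `t i \ t (i-1)`
(indices mod 5). -/
theorem no_closed_five_shell_with_both_repetitions {V : Type*} [DecidableEq V]
    (t : ℕ → Finset V) (hshell : IsClosedShell 5 t)
    (a b : ℕ → V)
    (ha : ∀ i < 5, t i \ t ((i + 1) % 5) = {a i})
    (hb : ∀ i < 5, t i \ t ((i + 5 - 1) % 5) = {b i}) :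
    ¬ (b 1 = a 2 ∧ a 1 = b 4) := by
  rintro ⟨h1, h2⟩
  obtain ⟨-, hadj, hnon⟩ := hshell
  have hb1 := hb 1 (by norm_num)
  have ha2 := ha 2 (by norm_num)
  have ha1 := ha 1 (by norm_num)
  have hb4 := hb 4 (by norm_num)
  have h40 := hadj 4 (by norm_num)
  have h03 := hnon 0 (by norm_num) 3 (by norm_num) (by norm_num) (by norm_num) (by norm_num)
  have h13 := hnon 1 (by norm_num) 3 (by norm_num) (by norm_num) (by norm_num) (by norm_num)
  have h14 := hnon 1 (by norm_num) 4 (by norm_num) (by norm_num) (by norm_num) (by norm_num)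
  norm_num at hb1 ha2 ha1 hb4 h40
  simp only [Finset.ext_iff, Finset.mem_sdiff, Finset.mem_singleton] at hb1 ha2 ha1 hb4
  -- a vertex `u` of `t 4 ∩ t 0` other than `b 4`; it lies in `t 3`
  obtain ⟨u, hu, huy⟩ := Finset.exists_mem_ne (by omega : 1 < (t 4 ∩ t 0).card) (b 4)
  obtain ⟨p, hp⟩ := Finset.card_eq_one.mp h03
  obtain ⟨z, hz⟩ := Finset.card_eq_one.mp h13
  obtain ⟨q, hq⟩ := Finset.card_eq_one.mp h14
  simp only [Finset.ext_iff, Finset.mem_inter, Finset.mem_singleton] at hp hz hq hu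
  have hz' := (hz z).2 rfl
  have hzx : z ≠ b 1 := fun h => ((ha2 z).2 (h.trans h1)).2 hz'.2
  have hz0 : z ∈ t 0 := by
    by_contra h
    exact hzx ((hb1 z).1 ⟨hz'.1, h⟩)
  have hu3 : u ∈ t 3 := by
    by_contra h
    exact huy ((hb4 u).1 ⟨hu.1, h⟩)
  have hzu : z = u := ((hp z).1 ⟨hz0, hz'.2⟩).trans ((hp u).1 ⟨hu.2, hu3⟩).symm
  have hy1 : b 4 ∈ t 1 := h2 ▸ ((ha1 (a 1)).2 rfl).1
  have hy4 : b 4 ∈ t 4 := ((hb4 (b 4)).2 rfl).1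
  exact huy (((hq u).1 ⟨hzu ▸ hz'.1, hu.1⟩).trans ((hq (b 4)).1 ⟨hy1, hy4⟩).symm)
end

section
/- Let t_0, …, t_5 be a closed 6-shell whose structural vertices satisfy b_1 = a_2 and a_1 = b_4. Then there exist pairwise distinct vertices c_0, …, c_5 such that the set {t_0, …, t_5} equals the set of six triangles {c_0, c_1, c_2}, {c_1, c_2, c_4}, {c_2, c_3, c_4}, {c_3, c_0, c_4}, {c_0, c_5, c_4}, {c_5, c_2, c_0}; that is, the shell is the 6-triangle Möbius band triangulation. -/
theorem shell_aux_one {V : Type*} [DecidableEq V] {s t : Finset V} (h : (s ∩ t).card = 1) :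
    ∀ x y, x ∈ s → x ∈ t → y ∈ s → y ∈ t → x = y := by
  intro x y h1 h2 h3 h4
  exact Finset.card_le_one.1 h.le x (Finset.mem_inter.2 ⟨h1, h2⟩) y (Finset.mem_inter.2 ⟨h3, h4⟩)

theorem shell_aux_ex {V : Type*} [DecidableEq V] {s t : Finset V} (h : (s ∩ t).card = 1) :
    ∃ x, x ∈ s ∧ x ∈ t := by
  obtain ⟨x, hx⟩ := Finset.card_pos.1 (h ▸ Nat.one_pos)
  exact ⟨x, Finset.mem_inter.1 hx⟩

theorem shell_aux_three {V : Type*} [DecidableEq V] {s : Finset V} (h : s.card = 3) {x y : V}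
    (hx : x ∈ s) (hy : y ∈ s) (hxy : x ≠ y) : ∃ z, z ≠ x ∧ z ≠ y ∧ s = {x, y, z} := by
  obtain ⟨u, v, w, h1, h2, h3, rfl⟩ := Finset.card_eq_three.1 h
  have : ((({u, v, w} : Finset V).erase x).erase y).card = 1 := by
    rw [Finset.card_erase_of_mem (by simp_all [eq_comm]), Finset.card_erase_of_mem hx, h]
  obtain ⟨z, hz⟩ := Finset.card_eq_one.1 this
  have hz1 : z ∈ (({u, v, w} : Finset V).erase x).erase y := by simp [hz]
  refine ⟨z, by grind, by grind, ?_⟩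
  rw [← hz, Finset.insert_erase (by grind), Finset.insert_erase hx]

theorem shell_aux_mem {V : Type*} [DecidableEq V] {s t : Finset V} {a : V} (h : s \ t = {a}) :
    a ∈ s ∧ a ∉ t ∧ ∀ z, z ∈ s → z ≠ a → z ∈ t := by
  have : ∀ z, z ∈ s \ t ↔ z = a := by simp [h]
  simp only [Finset.mem_sdiff] at this
  grind

theorem shell_aux_final {V : Type*} [DecidableEq V] (A x y q B p : V) :
    ({{y, A, p}, {x, A, y}, {x, y, B}, {y, B, q}, {A, B, q}, {A, B, p}} : Finset (Finset V)) =
      {{A, x, y}, {x, y, B}, {y, q, B}, {q, A, B}, {A, p, B}, {p, y, A}} := by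
  have f0 : ({y, A, p} : Finset V) = {p, y, A} := by ext; simp; tauto
  have f1 : ({x, A, y} : Finset V) = {A, x, y} := by ext; simp; tauto
  have f3 : ({y, B, q} : Finset V) = {y, q, B} := by ext; simp; tauto
  have f4 : ({A, B, q} : Finset V) = {q, A, B} := by ext; simp; tauto
  have f5 : ({A, B, p} : Finset V) = {A, p, B} := by ext; simp; tauto
  rw [f0, f1, f3, f4, f5]
  ext z
  simp only [Finset.mem_insert, Finset.mem_singleton]
  tauto

/-- A closed 6-shell whose structural vertices satisfy `b 1 = a 2` and
`a 1 = b 4` is the 6-triangle Möbius band triangulation: there are pairwise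
distinct vertices `c₀, …, c₅` such that the set of its six triangles is
`{{c₀,c₁,c₂}, {c₁,c₂,c₄}, {c₂,c₃,c₄}, {c₃,c₀,c₄}, {c₀,c₅,c₄}, {c₅,c₂,c₀}}`.
Here `a i` is the unique element of `t i \ t (i+1)` and `b i` the unique
element of `t i \ t (i-1)` (indices mod 6). -/
theorem closed_six_shell_is_Moebius {V : Type*} [DecidableEq V]
    (t : ℕ → Finset V) (hshell : IsClosedShell 6 t)
    (a b : ℕ → V)
    (ha : ∀ i < 6, t i \ t ((i + 1) % 6) = {a i})
    (hb : ∀ i < 6, t i \ t ((i + 6 - 1) % 6) = {b i})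
    (h1 : b 1 = a 2) (h2 : a 1 = b 4) :
    ∃ c₀ c₁ c₂ c₃ c₄ c₅ : V,
      [c₀, c₁, c₂, c₃, c₄, c₅].Pairwise (· ≠ ·) ∧
      ({t 0, t 1, t 2, t 3, t 4, t 5} : Finset (Finset V)) =
        {{c₀, c₁, c₂}, {c₁, c₂, c₄}, {c₂, c₃, c₄},
         {c₃, c₀, c₄}, {c₀, c₅, c₄}, {c₅, c₂, c₀}} := by
  obtain ⟨hc, -, ho⟩ := hshell
  obtain ⟨a1m, a1n, a1u⟩ := shell_aux_mem (ha 1 (by norm_num))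
  obtain ⟨a2m, a2n, a2u⟩ := shell_aux_mem (ha 2 (by norm_num))
  obtain ⟨a3m, a3n, a3u⟩ := shell_aux_mem (ha 3 (by norm_num))
  obtain ⟨a4m, a4n, a4u⟩ := shell_aux_mem (ha 4 (by norm_num))
  obtain ⟨a5m, a5n, a5u⟩ := shell_aux_mem (ha 5 (by norm_num))
  obtain ⟨b0m, b0n, b0u⟩ := shell_aux_mem (hb 0 (by norm_num))
  obtain ⟨b1m, b1n, b1u⟩ := shell_aux_mem (hb 1 (by norm_num))
  obtain ⟨b2m, b2n, b2u⟩ := shell_aux_mem (hb 2 (by norm_num))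
  obtain ⟨b4m, b4n, b4u⟩ := shell_aux_mem (hb 4 (by norm_num))
  obtain ⟨b5m, b5n, b5u⟩ := shell_aux_mem (hb 5 (by norm_num))
  have o02 := shell_aux_one (ho 0 (by simp) 2 (by simp) (by simp) (by simp) (by simp))
  have o03 := shell_aux_one (ho 0 (by simp) 3 (by simp) (by simp) (by simp) (by simp))
  have o04 := shell_aux_one (ho 0 (by simp) 4 (by simp) (by simp) (by simp) (by simp))
  have o13 := shell_aux_one (ho 1 (by simp) 3 (by simp) (by simp) (by simp) (by simp))
  have o14 := shell_aux_one (ho 1 (by simp) 4 (by simp) (by simp) (by simp) (by simp))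
  have o15 := shell_aux_one (ho 1 (by simp) 5 (by simp) (by simp) (by simp) (by simp))
  have o24 := shell_aux_one (ho 2 (by simp) 4 (by simp) (by simp) (by simp) (by simp))
  have o25 := shell_aux_one (ho 2 (by simp) 5 (by simp) (by simp) (by simp) (by simp))
  have o35 := shell_aux_one (ho 3 (by simp) 5 (by simp) (by simp) (by simp) (by simp))
  obtain ⟨w, w2, w5⟩ := shell_aux_ex (ho 2 (by simp) 5 (by simp) (by simp) (by simp) (by simp))
  have c0 := hc 0 (by simp)
  have c1 := hc 1 (by simp)
  have c2 := hc 2 (by simp)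
  have c3 := hc 3 (by simp)
  have c4 := hc 4 (by simp)
  have c5 := hc 5 (by simp)
  norm_num at a1n a2n a3n a4n a5n b0n b1n b2n b4n b5n a1u a2u a3u a4u a5u b0u b1u b2u b4u b5u
  clear ha hb ho hc
  rw [h1] at b1m b1n b1u
  rw [← h2] at b4m b4n b4u
  generalize a 2 = x at *
  generalize a 1 = A at *
  generalize b 2 = B at *
  generalize t 0 = t0 at *
  generalize t 1 = t1 at *
  generalize t 2 = t2 at *
  generalize t 3 = t3 at *
  generalize t 4 = t4 at *
  generalize t 5 = t5 at *
  have xA : x ≠ A := by grind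
  have xB : x ≠ B := by grind
  obtain ⟨y, yx, yA, e1⟩ := shell_aux_three c1 b1m a1m xA
  have y1 : y ∈ t1 := by simp [e1]
  have y2 : y ∈ t2 := a1u y y1 yA
  have y0 : y ∈ t0 := b1u y y1 yx
  have A0 : A ∈ t0 := b1u A a1m xA.symm
  have y3 : y ∈ t3 := a2u y y2 yx
  have B3 : B ∈ t3 := a2u B b2m xB.symm
  have yB : y ≠ B := by rintro rfl; exact b2n y1
  have AB : A ≠ B := by rintro rfl; exact b2n a1m
  have y4 : y ∉ t4 := fun h => yA (o14 _ _ y1 h a1m b4m)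
  have ya3 : y = a 3 := by grind
  have B4 : B ∈ t4 := a3u B B3 (by grind)
  obtain ⟨p, py, pA, e0⟩ := shell_aux_three c0 y0 A0 yA
  obtain ⟨q, qy, qB, e3⟩ := shell_aux_three c3 y3 B3 yB
  have q3 : q ∈ t3 := by simp [e3]
  have p0 : p ∈ t0 := by simp [e0]
  have q4 : q ∈ t4 := a3u q q3 (by grind)
  have qA : q ≠ A := by rintro rfl; exact b4n q3
  have A5 : A ∈ t5 := by
    by_contra h
    have hA : A = a 4 := by grind
    exact qB (o35 _ _ q3 (a4u q q4 (by grind)) B3 (a4u B B4 (by grind)))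
  have x5 : x ∉ t5 := fun h => xA (o15 _ _ b1m h a1m A5)
  have y5 : y ∉ t5 := fun h => yA (o15 _ _ y1 h a1m A5)
  obtain ⟨C, hB1, hB2, e2⟩ := shell_aux_three c2 a2m y2 yx.symm
  have hB : C = B := by
    rw [e2] at b2m
    simp only [Finset.mem_insert, Finset.mem_singleton] at b2m
    grind
  subst hB
  have B5 : C ∈ t5 := by
    rw [e2] at w2
    simp only [Finset.mem_insert, Finset.mem_singleton] at w2
    grind
  have p5 : p ∈ t5 := by grind
  have pB : p ≠ C := by rintro rfl; exact py (o02 _ _ p0 b2m y0 y2)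
  have pq : p ≠ q := by rintro rfl; exact py (o03 _ _ p0 q3 y0 y3)
  have px : p ≠ x := by rintro rfl; exact b1n p0
  have qx : q ≠ x := by rintro rfl; exact a2n q3
  have e4 : t4 = {A, C, q} := by
    obtain ⟨z, hz1, hz2, e⟩ := shell_aux_three c4 b4m B4 AB
    rw [e] at q4
    simp only [Finset.mem_insert, Finset.mem_singleton] at q4
    grind
  have e5 : t5 = {A, C, p} := by
    obtain ⟨z, hz1, hz2, e⟩ := shell_aux_three c5 A5 B5 AB
    rw [e] at p5
    simp only [Finset.mem_insert, Finset.mem_singleton] at p5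
    grind
  refine ⟨A, x, y, q, C, p, ?_, ?_⟩
  · simp only [List.pairwise_cons, List.mem_cons, List.not_mem_nil]
    grind
  · rw [e0, e1, e2, e3, e4, e5]
    exact shell_aux_final A x y q C p
end

section
/- Let T be the set of ten triangles of the half-icosahedron 𝓘/2. There exists a bijection f : T → T with |t_1 ∩ t_2| = |f(t_1) ∩ f(t_2)| for all t_1, t_2 ∈ T (an intersection-preserving map) such that no bijection g of the vertex set {x, a_0, …, a_4} satisfies g(t) = f(t) (as sets) for every t ∈ T; that is, f does not extend to an isomorphism. -/
/-- The set of ten triangles of the half-icosahedron `𝓘/2` on the vertices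
`x, a 0, …, a 4`: the triangles `{x, a i, a (i+1 mod 5)}` and
`{a i, a (i+1 mod 5), a (i+3 mod 5)}` for `0 ≤ i ≤ 4`. -/
def halfIcosahedronTriangles {V : Type*} [DecidableEq V] (x : V) (a : ℕ → V) :
    Finset (Finset V) :=
  (Finset.range 5).image (fun i => ({x, a i, a ((i + 1) % 5)} : Finset V)) ∪
  (Finset.range 5).image
    (fun i => ({a i, a ((i + 1) % 5), a ((i + 3) % 5)} : Finset V))

/-- The model triangles on `Fin 6`, where `5` plays the role of `x`. -/
def modelTriangles : Finset (Finset (Fin 6)) :=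
  {{5, 0, 1}, {5, 1, 2}, {5, 2, 3}, {5, 3, 4}, {5, 4, 0},
   {0, 1, 3}, {1, 2, 4}, {2, 3, 0}, {3, 4, 1}, {4, 0, 2}}

/-- Complement of the image under `i ↦ 2 i` (fixing the cone point). -/
def modelMap (t : Finset (Fin 6)) : Finset (Fin 6) :=
  (t.image ![0, 2, 4, 1, 3, 5])ᶜ

set_option maxRecDepth 100000 in
lemma modelMap_mem : ∀ t ∈ modelTriangles, modelMap t ∈ modelTriangles := by decide

set_option maxRecDepth 100000 in
lemma modelMap_inj : ∀ s ∈ modelTriangles, ∀ t ∈ modelTriangles,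
    modelMap s = modelMap t → s = t := by decide

set_option maxRecDepth 100000 in
lemma modelMap_surj : ∀ t ∈ modelTriangles, ∃ s ∈ modelTriangles, modelMap s = t := by decide

set_option maxRecDepth 100000 in
lemma modelMap_card : ∀ s ∈ modelTriangles, ∀ t ∈ modelTriangles,
    (s ∩ t).card = (modelMap s ∩ modelMap t).card := by decide

set_option maxRecDepth 100000 in
lemma modelMap_cone : ∀ v : Fin 6, ∃ t ∈ modelTriangles, 5 ∈ t ∧ v ∉ modelMap t := by decide

/-- On the triangle set `T` of the half-icosahedron there is an
intersection-preserving bijection `f : T → T` that does not extend to an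
isomorphism: no bijection `g` of the vertex set `{x, a 0, …, a 4}` satisfies
`g(t) = f(t)` for every `t ∈ T`. -/
theorem halfIcosahedron_has_nonextendable_intersection_preserving_map
    {V : Type*} [DecidableEq V] (x : V) (a : ℕ → V)
    (hainj : ∀ i < 5, ∀ j < 5, a i = a j → i = j)
    (hax : ∀ i < 5, a i ≠ x) :
    ∃ f : Finset V → Finset V,
      Set.BijOn f ↑(halfIcosahedronTriangles x a) ↑(halfIcosahedronTriangles x a) ∧
      (∀ t₁ ∈ halfIcosahedronTriangles x a, ∀ t₂ ∈ halfIcosahedronTriangles x a,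
        (t₁ ∩ t₂).card = (f t₁ ∩ f t₂).card) ∧
      ¬ ∃ g : V → V,
        Set.BijOn g ↑({x, a 0, a 1, a 2, a 3, a 4} : Finset V)
          ↑({x, a 0, a 1, a 2, a 3, a 4} : Finset V) ∧
        ∀ t ∈ halfIcosahedronTriangles x a, t.image g = f t := by
  set e : Fin 6 → V := ![a 0, a 1, a 2, a 3, a 4, x] with he
  have hinj : Function.Injective e := by
    have hx := fun i hi => (hax i hi).symm
    intro i j hij
    fin_cases i <;> fin_cases j <;> first
      | rfl
      | exact absurd hij (hax _ (by norm_num))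
      | exact absurd hij (hx _ (by norm_num))
      | exact absurd (hainj _ (by norm_num) _ (by norm_num) hij) (by norm_num)
  have hT : halfIcosahedronTriangles x a = modelTriangles.image (fun t => t.image e) := by
    have hr : Finset.range 5 = {0, 1, 2, 3, 4} := by decide
    simp only [halfIcosahedronTriangles, modelTriangles, hr, Finset.image_insert,
      Finset.image_singleton, Finset.insert_union, Finset.singleton_union]
    rfl
  have hpe : ∀ t : Finset (Fin 6), (t.image e).image (Function.invFun e) = t := by
    intro t
    rw [Finset.image_image, Function.invFun_comp hinj, Finset.image_id]
  have hI : Function.Injective (fun t : Finset (Fin 6) => t.image e) :=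
    Finset.image_injective hinj
  refine ⟨fun t => (modelMap (t.image (Function.invFun e))).image e, ⟨?_, ?_, ?_⟩, ?_, ?_⟩
  · intro t ht
    rw [hT] at ht ⊢
    obtain ⟨s, hs, rfl⟩ := Finset.mem_image.1 (Finset.mem_coe.1 ht)
    simp only [hpe]
    exact Finset.mem_coe.2 (Finset.mem_image.2 ⟨_, modelMap_mem s hs, rfl⟩)
  · intro t ht t' ht' h
    rw [hT] at ht ht'
    obtain ⟨s, hs, rfl⟩ := Finset.mem_image.1 (Finset.mem_coe.1 ht)
    obtain ⟨s', hs', rfl⟩ := Finset.mem_image.1 (Finset.mem_coe.1 ht')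
    simp only [hpe] at h
    rw [modelMap_inj s hs s' hs' (hI h)]
  · intro t ht
    rw [hT] at ht ⊢
    obtain ⟨s, hs, rfl⟩ := Finset.mem_image.1 (Finset.mem_coe.1 ht)
    obtain ⟨r, hr, rfl⟩ := modelMap_surj s hs
    refine ⟨r.image e, Finset.mem_coe.2 (Finset.mem_image.2 ⟨r, hr, rfl⟩), ?_⟩
    simp only [hpe]
  · intro t ht t' ht'
    rw [hT] at ht ht'
    obtain ⟨s, hs, rfl⟩ := Finset.mem_image.1 ht
    obtain ⟨s', hs', rfl⟩ := Finset.mem_image.1 ht'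
    simp only [hpe]
    rw [← Finset.image_inter _ _ hinj, ← Finset.image_inter _ _ hinj,
      Finset.card_image_of_injective _ hinj, Finset.card_image_of_injective _ hinj]
    exact modelMap_card s hs s' hs'
  · rintro ⟨g, -, hg⟩
    have key : ∀ t ∈ modelTriangles, 5 ∈ t → g x ∈ (modelMap t).image e := by
      intro t ht h5
      have h := hg (t.image e) (by rw [hT]; exact Finset.mem_image.2 ⟨t, ht, rfl⟩)
      simp only [hpe] at h
      rw [← h]
      exact Finset.mem_image_of_mem g (Finset.mem_image.2 ⟨5, h5, rfl⟩)
    obtain ⟨v, -, hv⟩ := Finset.mem_image.1 (key {5, 0, 1} (by decide) (by decide))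
    obtain ⟨t, ht, h5, hn⟩ := modelMap_cone v
    have h := key t ht h5
    rw [← hv] at h
    obtain ⟨w, hw, hwv⟩ := Finset.mem_image.1 h
    exact hn (hinj hwv ▸ hw)
end

section
/- Let T be the set of twelve triangles of the triangulated half-cube 𝓣𝓒/2. There exists a bijection f : T → T with |t_1 ∩ t_2| = |f(t_1) ∩ f(t_2)| for all t_1, t_2 ∈ T (an intersection-preserving map) such that no bijection g of the vertex set {x, a_0, …, a_5} satisfies g(t) = f(t) (as sets) for every t ∈ T; that is, f does not extend to an isomorphism. -/
/-- The set of twelve triangles of the triangulated half-cube `𝓣𝓒/2` on the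
vertices `x, a 0, …, a 5`: the triangles `{x, a i, a (i+1 mod 6)}` for
`0 ≤ i ≤ 5` together with `{a 0, a 1, a 4}`, `{a 1, a 2, a 4}`,
`{a 2, a 3, a 0}`, `{a 3, a 4, a 0}`, `{a 4, a 5, a 2}`, `{a 5, a 0, a 2}`. -/
def halfCubeTriangles {V : Type*} [DecidableEq V] (x : V) (a : ℕ → V) :
    Finset (Finset V) :=
  (Finset.range 6).image (fun i => ({x, a i, a ((i + 1) % 6)} : Finset V)) ∪
  ({{a 0, a 1, a 4}, {a 1, a 2, a 4}, {a 2, a 3, a 0},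
    {a 3, a 4, a 0}, {a 4, a 5, a 2}, {a 5, a 0, a 2}} : Finset (Finset V))

/-- The half-cube triangles on `Fin 7` (`0` plays `x`, and `i + 1` plays `a i`). -/
def halfCubeModel : Finset (Finset (Fin 7)) :=
  {{0, 1, 2}, {0, 2, 3}, {0, 3, 4}, {0, 4, 5}, {0, 5, 6}, {0, 6, 1},
   {1, 2, 5}, {2, 3, 5}, {3, 4, 1}, {4, 5, 1}, {5, 6, 3}, {6, 1, 3}}

/-- The involution exchanging two pairs of triangles. -/
def halfCubeSwap (t : Finset (Fin 7)) : Finset (Fin 7) :=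
  if t = {0, 4, 5} then {1, 3, 4} else
  if t = {1, 3, 4} then {0, 4, 5} else
  if t = {0, 5, 6} then {1, 3, 6} else
  if t = {1, 3, 6} then {0, 5, 6} else t

set_option maxRecDepth 100000 in
theorem halfCubeSwap_mem : ∀ t ∈ halfCubeModel, halfCubeSwap t ∈ halfCubeModel := by
  decide

set_option maxRecDepth 100000 in
theorem halfCubeSwap_invol : ∀ t ∈ halfCubeModel, halfCubeSwap (halfCubeSwap t) = t := by
  decide

set_option maxRecDepth 100000 in
theorem halfCubeSwap_card : ∀ t ∈ halfCubeModel, ∀ s ∈ halfCubeModel,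
    (t ∩ s).card = (halfCubeSwap t ∩ halfCubeSwap s).card := by
  decide

/-- On the triangle set `T` of the triangulated half-cube there is an
intersection-preserving bijection `f : T → T` that does not extend to an
isomorphism: no bijection `g` of the vertex set `{x, a 0, …, a 5}` satisfies
`g(t) = f(t)` for every `t ∈ T`. -/
theorem halfCube_has_nonextendable_intersection_preserving_map
    {V : Type*} [DecidableEq V] (x : V) (a : ℕ → V)
    (hainj : ∀ i < 6, ∀ j < 6, a i = a j → i = j)
    (hax : ∀ i < 6, a i ≠ x) :
    ∃ f : Finset V → Finset V,
      Set.BijOn f ↑(halfCubeTriangles x a) ↑(halfCubeTriangles x a) ∧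
      (∀ t₁ ∈ halfCubeTriangles x a, ∀ t₂ ∈ halfCubeTriangles x a,
        (t₁ ∩ t₂).card = (f t₁ ∩ f t₂).card) ∧
      ¬ ∃ g : V → V,
        Set.BijOn g ↑({x, a 0, a 1, a 2, a 3, a 4, a 5} : Finset V)
          ↑({x, a 0, a 1, a 2, a 3, a 4, a 5} : Finset V) ∧
        ∀ t ∈ halfCubeTriangles x a, t.image g = f t := by
  classical
  let v : Fin 7 → V := ![x, a 0, a 1, a 2, a 3, a 4, a 5]
  have hv : Function.Injective v := by
    have key : ∀ i : Fin 7, v i = if i = 0 then x else a (i.val - 1) := by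
      intro i; fin_cases i <;> rfl
    intro i j hij
    rw [key, key] at hij
    split_ifs at hij with h1 h2 h2
    · rw [h1, h2]
    · exact absurd hij.symm (hax _ (by omega))
    · exact absurd hij (hax _ (by omega))
    · have := hainj _ (by omega) _ (by omega) hij
      omega
  let e : Fin 7 ↪ V := ⟨v, hv⟩
  have hT : halfCubeTriangles x a = halfCubeModel.image (fun t => t.map e) := by
    simp [halfCubeTriangles, halfCubeModel, Finset.range_add_one, Finset.image_insert,
      Finset.map_insert, e, v]
    ext t
    simp only [Finset.mem_insert, Finset.mem_singleton]
    tauto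
  let p : Finset V → Finset (Fin 7) := fun t => Finset.univ.filter (fun i => e i ∈ t)
  have hp : ∀ t : Finset (Fin 7), p (t.map e) = t := by
    intro t; ext i; simp [p]
  let f : Finset V → Finset V := fun t => (halfCubeSwap (p t)).map e
  have hf : ∀ t : Finset (Fin 7), f (t.map e) = (halfCubeSwap t).map e := by
    intro t; simp only [f, hp]
  have hmem : ∀ t ∈ halfCubeModel, t.map e ∈ halfCubeTriangles x a := by
    intro t ht; rw [hT]; exact Finset.mem_image_of_mem _ ht
  have hex : ∀ t ∈ halfCubeTriangles x a, ∃ s ∈ halfCubeModel, s.map e = t := by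
    intro t ht; rw [hT] at ht; simpa using ht
  have hmaps : Set.MapsTo f ↑(halfCubeTriangles x a) ↑(halfCubeTriangles x a) := by
    intro t ht
    obtain ⟨s, hs, rfl⟩ := hex t ht
    rw [hf]
    exact hmem _ (halfCubeSwap_mem s hs)
  have hinv : Set.LeftInvOn f f ↑(halfCubeTriangles x a) := by
    intro t ht
    obtain ⟨s, hs, rfl⟩ := hex t ht
    rw [hf, hp, halfCubeSwap_invol s hs]
  refine ⟨f, Set.InvOn.bijOn ⟨hinv, hinv⟩ hmaps hmaps, ?_, ?_⟩
  · intro t₁ h₁ t₂ h₂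
    obtain ⟨s₁, hs₁, rfl⟩ := hex t₁ h₁
    obtain ⟨s₂, hs₂, rfl⟩ := hex t₂ h₂
    rw [hf, hf, ← Finset.map_inter, ← Finset.map_inter, Finset.card_map, Finset.card_map]
    exact halfCubeSwap_card s₁ hs₁ s₂ hs₂
  · rintro ⟨g, -, hg⟩
    have hstep : ∀ t ∈ halfCubeModel, 0 ∈ t → g (e 0) ∈ (halfCubeSwap t).map e := by
      intro t ht h0
      rw [← hf, ← hg _ (hmem t ht)]
      exact Finset.mem_image_of_mem _ (Finset.mem_map_of_mem _ h0)
    have h1 := hstep {0, 1, 2} (by decide) (by decide)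
    have h2 := hstep {0, 2, 3} (by decide) (by decide)
    have h3 := hstep {0, 4, 5} (by decide) (by decide)
    have h4 := Finset.mem_inter.2 ⟨Finset.mem_inter.2 ⟨h1, h2⟩, h3⟩
    rw [← Finset.map_inter, ← Finset.map_inter,
      show (halfCubeSwap {0, 1, 2} ∩ halfCubeSwap {0, 2, 3}) ∩ halfCubeSwap {0, 4, 5} = ∅
        by decide] at h4
    simp at h4
end
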